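/- Let U = [[A_U, B_U],[C_U, D_U]] and V = [[A_V, B_V],[C_V, D_V]] be complex block matrices with square blocks, where D_U and D_V are group invertible. Suppose R(C_U) ⊆ R(D_U) and R(B_Vᴴ) ⊆ R(D_Vᴴ). If (U, V) is a group inverse absorbing pair, then (D_U, D_V) is also a group inverse absorbing pair. -/

import Mathlib

open Matrix

/-- `X` is the group inverse of `A`. -/
def IsGroupInverse {n : Type*} [Fintype n] (A X : Matrix n n ℂ) : Prop :=
  A * X * A = A ∧ X * A * X = X ∧ A * X = X * A

/-- The column space (range) of a complex matrix. -/
noncomputable def colSpace {m n : Type*} [Fintype n] (A : Matrix m n ℂ) :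
    Submodule ℂ (m → ℂ) :=
  LinearMap.range A.mulVecLin

theorem exists_eq_mul_of_colSpace_le {l m n : Type*} [Fintype m] [Fintype n] [DecidableEq m]
    {C : Matrix l m ℂ} {D : Matrix l n ℂ} (h : colSpace C ≤ colSpace D) :
    ∃ S : Matrix n m ℂ, C = D * S := by
  have hcol (j : m) : ∃ v : n → ℂ, D *ᵥ v = C.col j :=
    h ⟨Pi.single j 1, by simp⟩
  choose v hv using hcol
  refine ⟨Matrix.of fun i j => v j i, ?_⟩
  ext i j
  exact (congrFun (hv j) i).symm

/-- The absorbing identity is equivalent to inclusions of column and row spaces, expressed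
through factorizations. -/
theorem IsGroupInverse.absorbing_iff {n : Type*} [Fintype n] {A B X Y : Matrix n n ℂ}
    (hA : IsGroupInverse A X) (hB : IsGroupInverse B Y) :
    X + Y = X * (A + B) * Y ↔ (∃ S, B = A * S) ∧ ∃ T, A = T * B := by
  obtain ⟨hA1, hA2, hA3⟩ := hA
  obtain ⟨hB1, hB2, hB3⟩ := hB
  constructor
  · intro h
    have hX : X = X * B * Y := by
      have h' : X * A * (X + Y) = X * A * (X * (A + B) * Y) := congrArg (X * A * ·) h
      have e : X * A * (X * (A + B) * Y) = X * A * Y + X * B * Y := by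
        rw [← Matrix.mul_assoc, ← Matrix.mul_assoc, hA2, Matrix.mul_add, Matrix.add_mul]
      rw [Matrix.mul_add, hA2, e, add_comm] at h'
      exact add_left_cancel h'
    have hY : Y = X * A * Y := by
      rw [Matrix.mul_add, Matrix.add_mul, ← hX, add_comm] at h
      exact add_right_cancel h
    refine ⟨⟨X * Y * B * B, ?_⟩, ⟨A * A * X * Y, ?_⟩⟩
    · calc B = Y * B * B := by rw [← hB3, hB1]
        _ = X * A * Y * B * B := by rw [← hY]
        _ = _ := by simp only [← hA3, Matrix.mul_assoc]
    · calc A = A * A * X := by rw [Matrix.mul_assoc, hA3, ← Matrix.mul_assoc, hA1]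
        _ = A * A * (X * B * Y) := by rw [← hX]
        _ = _ := by simp only [Matrix.mul_assoc, hB3]
  · rintro ⟨⟨S, hS⟩, ⟨T, hT⟩⟩
    have hAB : X * A * B = B := by
      rw [hS, ← Matrix.mul_assoc, ← hA3, hA1]
    have hBA : A * (B * Y) = A := by
      rw [hT, hB3, Matrix.mul_assoc, ← Matrix.mul_assoc B, hB1]
    have hY : X * A * Y = Y := by
      have e : Y = B * (Y * Y) := by rw [← Matrix.mul_assoc, hB3, hB2]
      rw [e, ← Matrix.mul_assoc, hAB]
    have hX : X * B * Y = X := by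
      have e : X = X * X * A := by rw [Matrix.mul_assoc, ← hA3, ← Matrix.mul_assoc, hA2]
      rw [e, Matrix.mul_assoc, Matrix.mul_assoc (X * X), hBA]
    rw [Matrix.mul_add, Matrix.add_mul, hX, hY, add_comm]

theorem inheritance_trailing_block_group_absorbing {a d : ℕ}
    (AU : Matrix (Fin a) (Fin a) ℂ) (BU : Matrix (Fin a) (Fin d) ℂ)
    (CU : Matrix (Fin d) (Fin a) ℂ) (DU : Matrix (Fin d) (Fin d) ℂ)
    (AV : Matrix (Fin a) (Fin a) ℂ) (BV : Matrix (Fin a) (Fin d) ℂ)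
    (CV : Matrix (Fin d) (Fin a) ℂ) (DV : Matrix (Fin d) (Fin d) ℂ)
    (DUg DVg : Matrix (Fin d) (Fin d) ℂ)
    (hDU : IsGroupInverse DU DUg) (hDV : IsGroupInverse DV DVg)
    (Ug Vg : Matrix (Fin a ⊕ Fin d) (Fin a ⊕ Fin d) ℂ)
    (hU : IsGroupInverse (Matrix.fromBlocks AU BU CU DU) Ug)
    (hV : IsGroupInverse (Matrix.fromBlocks AV BV CV DV) Vg)
    (h1 : colSpace CU ≤ colSpace DU)
    (h2 : colSpace BVᴴ ≤ colSpace DVᴴ)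
    (habs : Ug + Vg =
      Ug * (Matrix.fromBlocks AU BU CU DU + Matrix.fromBlocks AV BV CV DV) * Vg) :
    DUg + DVg = DUg * (DU + DV) * DVg := by
  obtain ⟨⟨S, hS⟩, ⟨T, hT⟩⟩ := (hU.absorbing_iff hV).1 habs
  obtain ⟨P, hP⟩ := exists_eq_mul_of_colSpace_le h1
  obtain ⟨Q, hQ⟩ := exists_eq_mul_of_colSpace_le h2
  replace hQ : BV = Qᴴ * DV := by
    simpa using congrArg Matrix.conjTranspose hQ
  rw [← Matrix.fromBlocks_toBlocks S, Matrix.fromBlocks_multiply, Matrix.fromBlocks_inj] at hS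
  rw [← Matrix.fromBlocks_toBlocks T, Matrix.fromBlocks_multiply, Matrix.fromBlocks_inj] at hT
  refine (hDU.absorbing_iff hDV).2
    ⟨⟨P * S.toBlocks₁₂ + S.toBlocks₂₂, ?_⟩, ⟨T.toBlocks₂₁ * Qᴴ + T.toBlocks₂₂, ?_⟩⟩
  · rw [Matrix.mul_add, ← Matrix.mul_assoc, ← hP]
    exact hS.2.2.2
  · rw [Matrix.add_mul, Matrix.mul_assoc, ← hQ]
    exact hT.2.2.2
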